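/- Let F_{L_0} and F_{L_1} be the classes of unimodal Kripke frames (in disjoint signatures {0} and {1}) of the logics L_0 and L_1, where L_0, L_1 ∈ {K, K4, S4, KD45, S5, GL}: F_K is the class of all frames, F_K4 the transitive frames, F_S4 the reflexive transitive frames, F_KD45 the serial transitive euclidean frames, F_S5 the frames whose relation is an equivalence relation, and F_GL the transitive frames with no infinite ascending R-chains. Then the μ-calculus' alternation hierarchy is strict over the fusion F_{L_0} ⊗ F_{L_1}: for every n ∈ ℕ there is a μ-formula in Σ^μ_{n+1} ∪ Π^μ_{n+1} which is not equivalent over F_{L_0} ⊗ F_{L_1} to any μ-formula in Σ^μ_n ∪ Π^μ_n. -/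

import Mathlib

/- ### μ-calculus: syntax and Kripke semantics -/

/-- μ-formulas over a modal signature `Λ`, with propositional symbols and
variables indexed by `ℕ`; negation applies to propositional symbols only. -/
inductive MuForm (Λ : Type) : Type where
  | prop : ℕ → MuForm Λ
  | nprop : ℕ → MuForm Λ
  | var : ℕ → MuForm Λ
  | and : MuForm Λ → MuForm Λ → MuForm Λ
  | or : MuForm Λ → MuForm Λ → MuForm Λ
  | box : Λ → MuForm Λ → MuForm Λ
  | dia : Λ → MuForm Λ → MuForm Λ
  | mu : ℕ → MuForm Λ → MuForm Λ
  | nu : ℕ → MuForm Λ → MuForm Λ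

/-- A Kripke model over signature `Λ` with set of worlds `W`. -/
structure KModel (Λ W : Type) where
  R : Λ → W → W → Prop
  V : ℕ → Set W

namespace MuForm

variable {Λ W : Type}

/-- The valuation `‖φ‖^M` of a μ-formula, where `env` interprets the variables;
least and greatest fixed points are taken in the complete lattice `Set W`. -/
def sem (M : KModel Λ W) (env : ℕ → Set W) : MuForm Λ → Set W
  | prop p => M.V p
  | nprop p => (M.V p)ᶜ
  | var x => env x
  | and a b => sem M env a ∩ sem M env b
  | or a b => sem M env a ∪ sem M env b
  | box i a => {w | ∀ v, M.R i w v → v ∈ sem M env a}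
  | dia i a => {w | ∃ v, M.R i w v ∧ v ∈ sem M env a}
  | mu x a => sInf {A : Set W | sem M (Function.update env x A) a ⊆ A}
  | nu x a => sSup {A : Set W | A ⊆ sem M (Function.update env x A) a}

/-- Free variables of a μ-formula. -/
def freeVars : MuForm Λ → Set ℕ
  | prop _ => ∅
  | nprop _ => ∅
  | var x => {x}
  | and a b => freeVars a ∪ freeVars b
  | or a b => freeVars a ∪ freeVars b
  | box _ a => freeVars a
  | dia _ a => freeVars a
  | mu x a => freeVars a \ {x}
  | nu x a => freeVars a \ {x}

/-- A μ-formula contains no fixed-point operators. -/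
def noFix : MuForm Λ → Prop
  | prop _ => True
  | nprop _ => True
  | var _ => True
  | and a b => noFix a ∧ noFix b
  | or a b => noFix a ∧ noFix b
  | box _ a => noFix a
  | dia _ a => noFix a
  | mu _ _ => False
  | nu _ _ => False

/-- The list of subformulas of a μ-formula. -/
def subfs : MuForm Λ → List (MuForm Λ)
  | prop p => [prop p]
  | nprop p => [nprop p]
  | var x => [var x]
  | and a b => (and a b) :: (subfs a ++ subfs b)
  | or a b => (or a b) :: (subfs a ++ subfs b)
  | box i a => (box i a) :: subfs a
  | dia i a => (dia i a) :: subfs a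
  | mu x a => (mu x a) :: subfs a
  | nu x a => (nu x a) :: subfs a

/-- Substitution of `ψ` for the free occurrences of the variable `X`. -/
def subst (X : ℕ) (ψ : MuForm Λ) : MuForm Λ → MuForm Λ
  | prop p => prop p
  | nprop p => nprop p
  | var y => if y = X then ψ else var y
  | and a b => and (subst X ψ a) (subst X ψ b)
  | or a b => or (subst X ψ a) (subst X ψ b)
  | box i a => box i (subst X ψ a)
  | dia i a => dia i (subst X ψ a)
  | mu y a => if y = X then mu y a else mu y (subst X ψ a)
  | nu y a => if y = X then nu y a else nu y (subst X ψ a)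

/-- The substitution of `ψ` for `X` is capture-free: no free variable of `ψ`
becomes bound when substituting `ψ` for the free occurrences of `X`. -/
def CaptureFree (X : ℕ) (ψ : MuForm Λ) : MuForm Λ → Prop
  | prop _ => True
  | nprop _ => True
  | var _ => True
  | and a b => CaptureFree X ψ a ∧ CaptureFree X ψ b
  | or a b => CaptureFree X ψ a ∧ CaptureFree X ψ b
  | box _ a => CaptureFree X ψ a
  | dia _ a => CaptureFree X ψ a
  | mu y a => y = X ∨ ((X ∈ freeVars a → y ∉ freeVars ψ) ∧ CaptureFree X ψ a)
  | nu y a => y = X ∨ ((X ∈ freeVars a → y ∉ freeVars ψ) ∧ CaptureFree X ψ a)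

/-- Number of occurrences of the variable `X`. -/
def varCnt (X : ℕ) : MuForm Λ → ℕ
  | prop _ => 0
  | nprop _ => 0
  | var y => if y = X then 1 else 0
  | and a b => varCnt X a + varCnt X b
  | or a b => varCnt X a + varCnt X b
  | box _ a => varCnt X a
  | dia _ a => varCnt X a
  | mu _ a => varCnt X a
  | nu _ a => varCnt X a

/-- Number of fixed-point binders binding the variable `X`. -/
def bndCnt (X : ℕ) : MuForm Λ → ℕ
  | prop _ => 0
  | nprop _ => 0
  | var _ => 0
  | and a b => bndCnt X a + bndCnt X b
  | or a b => bndCnt X a + bndCnt X b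
  | box _ a => bndCnt X a
  | dia _ a => bndCnt X a
  | mu y a => (if y = X then 1 else 0) + bndCnt X a
  | nu y a => (if y = X then 1 else 0) + bndCnt X a

end MuForm

/-- Each variable has at most one occurrence, is bound by at most one
fixed-point operator, and no variable occurs free. -/
def WellNamed {Λ : Type} (φ : MuForm Λ) : Prop :=
  (∀ X : ℕ, MuForm.varCnt X φ ≤ 1 ∧ MuForm.bndCnt X φ ≤ 1) ∧ MuForm.freeVars φ = ∅

/- ### The alternation hierarchy Σ^μ_n / Π^μ_n -/

mutual
  /-- The class `Σ^μ_n` of the alternation hierarchy. -/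
  inductive SigmaMu {Λ : Type} : ℕ → MuForm Λ → Prop where
    | base {φ : MuForm Λ} : φ.noFix → SigmaMu 0 φ
    | upS {n : ℕ} {φ : MuForm Λ} : SigmaMu n φ → SigmaMu (n + 1) φ
    | upP {n : ℕ} {φ : MuForm Λ} : PiMu n φ → SigmaMu (n + 1) φ
    | andI {n : ℕ} {a b : MuForm Λ} :
        SigmaMu (n + 1) a → SigmaMu (n + 1) b → SigmaMu (n + 1) (MuForm.and a b)
    | orI {n : ℕ} {a b : MuForm Λ} :
        SigmaMu (n + 1) a → SigmaMu (n + 1) b → SigmaMu (n + 1) (MuForm.or a b)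
    | boxI {n : ℕ} {i : Λ} {a : MuForm Λ} :
        SigmaMu (n + 1) a → SigmaMu (n + 1) (MuForm.box i a)
    | diaI {n : ℕ} {i : Λ} {a : MuForm Λ} :
        SigmaMu (n + 1) a → SigmaMu (n + 1) (MuForm.dia i a)
    | muI {n : ℕ} {X : ℕ} {a : MuForm Λ} :
        SigmaMu (n + 1) a → SigmaMu (n + 1) (MuForm.mu X a)
    | substI {n : ℕ} {X : ℕ} {a ψ : MuForm Λ} :
        SigmaMu (n + 1) a → SigmaMu (n + 1) ψ → MuForm.CaptureFree X ψ a →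
        SigmaMu (n + 1) (MuForm.subst X ψ a)

  /-- The class `Π^μ_n` of the alternation hierarchy. -/
  inductive PiMu {Λ : Type} : ℕ → MuForm Λ → Prop where
    | base {φ : MuForm Λ} : φ.noFix → PiMu 0 φ
    | upS {n : ℕ} {φ : MuForm Λ} : SigmaMu n φ → PiMu (n + 1) φ
    | upP {n : ℕ} {φ : MuForm Λ} : PiMu n φ → PiMu (n + 1) φ
    | andI {n : ℕ} {a b : MuForm Λ} :
        PiMu (n + 1) a → PiMu (n + 1) b → PiMu (n + 1) (MuForm.and a b)
    | orI {n : ℕ} {a b : MuForm Λ} :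
        PiMu (n + 1) a → PiMu (n + 1) b → PiMu (n + 1) (MuForm.or a b)
    | boxI {n : ℕ} {i : Λ} {a : MuForm Λ} :
        PiMu (n + 1) a → PiMu (n + 1) (MuForm.box i a)
    | diaI {n : ℕ} {i : Λ} {a : MuForm Λ} :
        PiMu (n + 1) a → PiMu (n + 1) (MuForm.dia i a)
    | nuI {n : ℕ} {X : ℕ} {a : MuForm Λ} :
        PiMu (n + 1) a → PiMu (n + 1) (MuForm.nu X a)
    | substI {n : ℕ} {X : ℕ} {a ψ : MuForm Λ} :
        PiMu (n + 1) a → PiMu (n + 1) ψ → MuForm.CaptureFree X ψ a →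
        PiMu (n + 1) (MuForm.subst X ψ a)
end

/- ### Kripke frames, closure conditions, fusions, equivalence -/

/-- A Kripke frame over the signature `Λ`. -/
structure Frame (Λ : Type) : Type 1 where
  World : Type
  R : Λ → World → World → Prop

/-- Frame isomorphism. -/
def FrameIso {Λ : Type} (F G : Frame Λ) : Prop :=
  ∃ e : F.World ≃ G.World, ∀ (i : Λ) (w v : F.World), F.R i w v ↔ G.R i (e w) (e v)

/-- A class of frames is closed under isomorphic copies. -/
def ClosedUnderIso {Λ : Type} (C : Set (Frame Λ)) : Prop :=
  ∀ F ∈ C, ∀ G : Frame Λ, FrameIso F G → G ∈ C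

/-- Disjoint union of a family of frames. -/
def Frame.disjUnion {Λ ι : Type} (f : ι → Frame Λ) : Frame Λ where
  World := Σ i : ι, (f i).World
  R m x y :=
    ∃ h : x.1 = y.1, (f y.1).R m (cast (congrArg (fun i => (f i).World) h) x.2) y.2

/-- A class of frames is closed under disjoint unions. -/
def ClosedUnderDU {Λ : Type} (C : Set (Frame Λ)) : Prop :=
  ∀ (ι : Type) (f : ι → Frame Λ), (∀ i, f i ∈ C) → Frame.disjUnion f ∈ C

/-- `∘→∘` is a subframe of the class `C` of unimodal frames. -/
def HasEdge (C : Set (Frame Unit)) : Prop :=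
  ∃ F ∈ C, ∃ w0 w1 : F.World, w0 ≠ w1 ∧ F.R () w0 w1

/-- `∘←∘→∘` is a subframe of the class `C` of unimodal frames. -/
def HasFork (C : Set (Frame Unit)) : Prop :=
  ∃ F ∈ C, ∃ w0 w1 w2 : F.World,
    w0 ≠ w1 ∧ w0 ≠ w2 ∧ w1 ≠ w2 ∧ F.R () w0 w1 ∧ F.R () w0 w2

/-- `∘→∘→∘` is a subframe of the class `C` of unimodal frames. -/
def HasChain2 (C : Set (Frame Unit)) : Prop :=
  ∃ F ∈ C, ∃ w0 w1 w2 : F.World,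
    w0 ≠ w1 ∧ w0 ≠ w2 ∧ w1 ≠ w2 ∧ F.R () w0 w1 ∧ F.R () w1 w2

/-- The unimodal reduct of a bimodal frame. -/
def Frame.reduct2 (F : Frame (Fin 2)) (i : Fin 2) : Frame Unit :=
  ⟨F.World, fun _ => F.R i⟩

/-- Fusion of two classes of unimodal frames (signatures `{0}` and `{1}`). -/
def fusion2 (C0 C1 : Set (Frame Unit)) : Set (Frame (Fin 2)) :=
  {F | F.reduct2 0 ∈ C0 ∧ F.reduct2 1 ∈ C1}

/-- The unimodal reduct of a trimodal frame. -/
def Frame.reduct3 (F : Frame (Fin 3)) (i : Fin 3) : Frame Unit :=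
  ⟨F.World, fun _ => F.R i⟩

/-- Fusion of three classes of unimodal frames. -/
def fusion3 (C0 C1 C2 : Set (Frame Unit)) : Set (Frame (Fin 3)) :=
  {F | F.reduct3 0 ∈ C0 ∧ F.reduct3 1 ∈ C1 ∧ F.reduct3 2 ∈ C2}

/-- Two μ-formulas are equivalent over a class of frames: they have the same
valuation in every model based on a frame of the class. -/
def EquivOver {Λ : Type} (C : Set (Frame Λ)) (φ ψ : MuForm Λ) : Prop :=
  ∀ F ∈ C, ∀ (V : ℕ → Set F.World) (env : ℕ → Set F.World),
    MuForm.sem ⟨F.R, V⟩ env φ = MuForm.sem ⟨F.R, V⟩ env ψ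

/- ### Games, strategies, evaluation games, parity games -/

/-- A two-player game on a graph: positions owned by `ownV` belong to
Verifier/∃, the others to Refuter/∀; `winV` decides infinite plays.
A player who cannot move loses. -/
structure Game (Pos : Type) where
  init : Pos
  ownV : Pos → Prop
  move : Pos → Pos → Prop
  winV : (ℕ → Pos) → Prop

/-- The history (current position first) of an infinite play after `n` steps. -/
def histN {Pos : Type} (p : ℕ → Pos) (n : ℕ) : List Pos :=
  ((List.range (n + 1)).map p).reverse

/-- Finite histories (current position first) of plays in which the player
owning the `own`-positions follows the strategy `σ`. -/
inductive Game.Hist {Pos : Type} (G : Game Pos) (own : Pos → Prop)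
    (σ : List Pos → Pos) : List Pos → Prop where
  | init : Game.Hist G own σ [G.init]
  | smove {l : List Pos} {x : Pos} : Game.Hist G own σ (x :: l) → own x →
      G.move x (σ (x :: l)) → Game.Hist G own σ (σ (x :: l) :: x :: l)
  | omove {l : List Pos} {x y : Pos} : Game.Hist G own σ (x :: l) → ¬ own x →
      G.move x y → Game.Hist G own σ (y :: x :: l)

/-- The player owning the `own`-positions has a winning strategy:
a strategy which always provides a legal move at reachable own positions
(so the player is never stuck) and such that every infinite play following it
satisfies the winning condition `winO`; finite plays in which the opponent is
stuck are automatically won. -/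
def Game.WinsFor {Pos : Type} (G : Game Pos) (own : Pos → Prop)
    (winO : (ℕ → Pos) → Prop) : Prop :=
  ∃ σ : List Pos → Pos,
    (∀ (l : List Pos) (x : Pos), G.Hist own σ (x :: l) → own x →
      G.move x (σ (x :: l))) ∧
    (∀ p : ℕ → Pos, p 0 = G.init → (∀ n, G.move (p n) (p (n + 1))) →
      (∀ n, own (p n) → p (n + 1) = σ (histN p n)) → winO p)

/-- Verifier has a winning strategy. -/
def Game.VWins {Pos : Type} (G : Game Pos) : Prop := G.WinsFor G.ownV G.winV

/-- Refuter has a winning strategy. -/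
def Game.RWins {Pos : Type} (G : Game Pos) : Prop :=
  G.WinsFor (fun x => ¬ G.ownV x) (fun p => ¬ G.winV p)

/-- Ownership of positions in the evaluation game `𝒢(M, w ⊨ φ0)`:
Verifier owns disjunctions, diamonds, μ-formulas, μ-bound variables and
false literals. -/
def evalOwnV {Λ W : Type} (M : KModel Λ W) (φ0 : MuForm Λ) :
    MuForm Λ × W → Prop := fun q =>
  match q with
  | (.or _ _, _) => True
  | (.dia _ _, _) => True
  | (.mu _ _, _) => True
  | (.var X, _) => ∃ a : MuForm Λ, (MuForm.mu X a) ∈ φ0.subfs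
  | (.prop p, w) => w ∉ M.V p
  | (.nprop p, w) => w ∈ M.V p
  | _ => False

/-- Admissible moves in the evaluation game `𝒢(M, w ⊨ φ0)`. -/
def evalMove {Λ W : Type} (M : KModel Λ W) (φ0 : MuForm Λ) :
    MuForm Λ × W → MuForm Λ × W → Prop := fun q r =>
  match q with
  | (.and a b, w) => r = (a, w) ∨ r = (b, w)
  | (.or a b, w) => r = (a, w) ∨ r = (b, w)
  | (.box i a, w) => ∃ v, M.R i w v ∧ r = (a, v)
  | (.dia i a, w) => ∃ v, M.R i w v ∧ r = (a, v)
  | (.mu _ a, w) => r = (a, w)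
  | (.nu _ a, w) => r = (a, w)
  | (.var X, w) =>
      ∃ a : MuForm Λ,
        ((MuForm.mu X a) ∈ φ0.subfs ∧ r = (MuForm.mu X a, w)) ∨
        ((MuForm.nu X a) ∈ φ0.subfs ∧ r = (MuForm.nu X a, w))
  | (.prop _, _) => False
  | (.nprop _, _) => False

/-- The formula `ψ` labels infinitely many positions of the infinite run `p`. -/
def InfOccF {Λ W : Type} (p : ℕ → MuForm Λ × W) (ψ : MuForm Λ) : Prop :=
  ∀ n, ∃ m, n ≤ m ∧ (p m).1 = ψ

/-- Verifier wins an infinite run iff the outermost fixed-point subformula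
occurring infinitely often is a ν-formula. -/
def evalWinV {Λ W : Type} (p : ℕ → MuForm Λ × W) : Prop :=
  ∃ (X : ℕ) (a : MuForm Λ), InfOccF p (MuForm.nu X a) ∧
    ∀ χ : MuForm Λ, InfOccF p χ → χ ∈ (MuForm.nu X a).subfs

/-- The evaluation game `𝒢(M, w ⊨ φ)`. -/
def evalGame {Λ W : Type} (M : KModel Λ W) (w : W) (φ : MuForm Λ) :
    Game (MuForm Λ × W) where
  init := (φ, w)
  ownV := evalOwnV M φ
  move := evalMove M φ
  winV := evalWinV

/-- A parity game. -/
structure PGame : Type 1 where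
  Pos : Type
  ownE : Pos → Prop
  init : Pos
  E : Pos → Pos → Prop
  Ω : Pos → ℕ

/-- The parity `k` occurs infinitely often in the infinite play `p`. -/
def InfOccPar (P : PGame) (p : ℕ → P.Pos) (k : ℕ) : Prop :=
  ∀ n, ∃ m, n ≤ m ∧ P.Ω (p m) = k

/-- A parity game as a game: ∃ wins an infinite play iff the greatest parity
occurring infinitely often is even. -/
def PGame.toGame (P : PGame) : Game P.Pos where
  init := P.init
  ownV := P.ownE
  move := P.E
  winV := fun p => ∃ k, Even k ∧ InfOccPar P p k ∧ ∀ j, InfOccPar P p j → j ≤ k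

/-- Player ∃ wins the parity game. -/
def PGame.ExWins (P : PGame) : Prop := P.toGame.VWins

/-- Player ∀ wins the parity game. -/
def PGame.AWins (P : PGame) : Prop := P.toGame.RWins

/-- The parity of a fixed-point formula: `2(i+ε) − 1` for a μ-formula in
`Σ^μ_{2i+ε} \ Π^μ_{2i+ε}`, `2i` for a ν-formula in `Π^μ_{2i+ε} \ Σ^μ_{2i+ε}`,
and `0` for non fixed-point formulas. -/
noncomputable def fpParity {Λ : Type} : MuForm Λ → ℕ := fun φ =>
  match φ with
  | .mu _ _ =>
      (fun ℓ => if Even ℓ then ℓ - 1 else ℓ) (sInf {k | SigmaMu k φ ∧ ¬ PiMu k φ})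
  | .nu _ _ =>
      (fun ℓ => if Even ℓ then ℓ else ℓ - 1) (sInf {k | PiMu k φ ∧ ¬ SigmaMu k φ})
  | _ => 0

/-- The evaluation game `𝒢(M, w ⊨ φ)` presented as the parity game
`𝒢^P(M, w ⊨ φ)`. -/
noncomputable def evalPGame {Λ W : Type} (M : KModel Λ W) (w : W)
    (φ : MuForm Λ) : PGame where
  Pos := MuForm Λ × W
  ownE := evalOwnV M φ
  init := (φ, w)
  E := evalMove M φ
  Ω := fun q => fpParity q.1

/- ### Tree unfolding of a parity game -/

/-- Finite `E`-paths of a parity game starting at the initial position,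
presented as (last vertex, reversed list of earlier vertices). -/
inductive IsUPath (P : PGame) : P.Pos × List P.Pos → Prop where
  | init : IsUPath P (P.init, [])
  | cons {u : P.Pos} {t : List P.Pos} {v : P.Pos} :
      IsUPath P (u, t) → P.E u v → IsUPath P (v, u :: t)

/-- The tree unfolding of a parity game: positions are the finite `E`-paths
starting at the initial position, with ownership and parity inherited from
the last vertex. -/
def PGame.unfold (P : PGame) : PGame where
  Pos := {q : P.Pos × List P.Pos // IsUPath P q}
  ownE := fun q => P.ownE q.val.1
  init := ⟨(P.init, []), IsUPath.init⟩
  E := fun q r => r.val.2 = q.val.1 :: q.val.2 ∧ P.E q.val.1 r.val.1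
  Ω := fun q => P.Ω q.val.1

/- ### The Kripke encoding of parity games and the formulas W_n -/

/- Propositional indices used for the encoding:
`bd = 0`, `pos = 1`, `pre₀ = 2`, `nxt₀ = 3`, `pre₁ = 4`, `nxt₁ = 5`,
`P_∃ = 6`, `P_∀ = 7`, `P_j = 8 + j`. -/

/-- Worlds of the Kripke model encoding a parity game: a world `pos v` for
each position `v`, and intermediate choice/confirmation worlds `mid u u'`
for the edges. -/
inductive EncW (Pos : Type) : Type where
  | pos : Pos → EncW Pos
  | mid : Pos → Pos → EncW Pos

/-- Choice steps (`R₀`) of the encoding. -/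
def encR0 (P : PGame) : EncW P.Pos → EncW P.Pos → Prop
  | EncW.pos v, EncW.mid u u' => v = u ∧ P.E u u'
  | _, _ => False

/-- Confirmation steps (`R₁`) of the encoding. -/
def encR1 (P : PGame) : EncW P.Pos → EncW P.Pos → Prop
  | EncW.mid u u', EncW.pos v => v = u' ∧ P.E u u'
  | _, _ => False

/-- Valuation of the encoding. -/
def encV (P : PGame) : ℕ → Set (EncW P.Pos) := fun n =>
  if n = 0 then Set.univ                                         -- bd
  else if n = 1 then {x | ∃ v, x = EncW.pos v}                   -- pos
  else if n = 2 then {x | ∃ v, x = EncW.pos v}                   -- pre₀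
  else if n = 3 then {x | ∃ u u', x = EncW.mid u u'}             -- nxt₀
  else if n = 4 then {x | ∃ u u', x = EncW.mid u u'}             -- pre₁
  else if n = 5 then {x | ∃ v, x = EncW.pos v}                   -- nxt₁
  else if n = 6 then {x | ∃ v, x = EncW.pos v ∧ P.ownE v}        -- P_∃
  else if n = 7 then {x | ∃ v, x = EncW.pos v ∧ ¬ P.ownE v}      -- P_∀
  else {x | ∃ v, x = EncW.pos v ∧ P.Ω v = n - 8}                 -- P_{n-8}

/-- The bimodal Kripke model `P^K` encoding the parity game `P`. -/
def encModel (P : PGame) : KModel (Fin 2) (EncW P.Pos) where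
  R := fun i => if i = 0 then encR0 P else encR1 P
  V := encV P

/-- `♦φ := νY. pre₀ ∧ bd ∧ ◇₀(nxt₀ ∧ pre₁ ∧ bd ∧ ◇₁(nxt₁ ∧ bd ∧
((Y ∧ ¬pos) ∨ (φ ∧ pos))))`. -/
def DiamW (Y : ℕ) (φ : MuForm (Fin 2)) : MuForm (Fin 2) :=
  .nu Y (.and (.prop 2) (.and (.prop 0)
    (.dia 0 (.and (.prop 3) (.and (.prop 4) (.and (.prop 0)
      (.dia 1 (.and (.prop 5) (.and (.prop 0)
        (.or (.and (.var Y) (.nprop 1)) (.and φ (.prop 1))))))))))))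

/-- `■φ := νY. (pre₀ ∧ bd → □₀(nxt₀ ∧ pre₁ ∧ bd → □₁(nxt₁ ∧ bd →
((Y ∧ ¬pos) ∧ (φ ∧ pos)))))`, implications written disjunctively. -/
def BoxW (Y : ℕ) (φ : MuForm (Fin 2)) : MuForm (Fin 2) :=
  .nu Y (.or (.or (.nprop 2) (.nprop 0))
    (.box 0 (.or (.or (.nprop 3) (.or (.nprop 4) (.nprop 0)))
      (.box 1 (.or (.or (.nprop 5) (.nprop 0))
        (.and (.and (.var Y) (.nprop 1)) (.and φ (.prop 1))))))))

/-- The `j`-th disjunct `(P_j ∧ P_∃ ∧ ♦X_j) ∨ (P_j ∧ P_∀ ∧ ■X_j)`. -/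
def WDisj (Y j : ℕ) : MuForm (Fin 2) :=
  .or (.and (.prop (8 + j)) (.and (.prop 6) (DiamW Y (.var j))))
      (.and (.prop (8 + j)) (.and (.prop 7) (BoxW Y (.var j))))

/-- The disjunction `⋁_{0 ≤ j ≤ n} [(P_j ∧ P_∃ ∧ ♦X_j) ∨ (P_j ∧ P_∀ ∧ ■X_j)]`. -/
def WBody (Y : ℕ) : ℕ → MuForm (Fin 2)
  | 0 => WDisj Y 0
  | j + 1 => .or (WBody Y (j)) (WDisj Y (j + 1))

/-- The alternating block of binders `ηX_n … νX_2 μX_1 νX_0`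
(`νX_j` for even `j`, `μX_j` for odd `j`). -/
def WBind : ℕ → MuForm (Fin 2) → MuForm (Fin 2)
  | 0, φ => .nu 0 φ
  | j + 1, φ =>
      if Even (j + 1) then .nu (j + 1) (WBind j φ) else .mu (j + 1) (WBind j φ)

/-- The winning region formula
`W_n := ηX_n … νX_2 μX_1 νX_0. ⋁_{0≤j≤n} [(P_j ∧ P_∃ ∧ ♦X_j) ∨ (P_j ∧ P_∀ ∧ ■X_j)]`,
where the fresh variable `Y` of `♦`/`■` is `n + 1`. -/
def Wfml (n : ℕ) : MuForm (Fin 2) := WBind n (WBody (n + 1) n)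

/- ### Pointed bimodal models, restriction, isomorphisms, the map f_φ -/

/-- A pointed bimodal Kripke model. -/
structure PModel : Type 1 where
  World : Type
  R0 : World → World → Prop
  R1 : World → World → Prop
  V : ℕ → Set World
  pt : World

/-- The underlying bimodal Kripke model. -/
def PModel.toK (M : PModel) : KModel (Fin 2) M.World :=
  ⟨fun i => if i = 0 then M.R0 else M.R1, M.V⟩

/-- The edges of the graph of a pointed bimodal model. -/
def PModel.edge (M : PModel) (x y : M.World) : Prop := M.R0 x y ∨ M.R1 x y

/-- The graph of the model has no loops. -/
def PModel.Acyclic (M : PModel) : Prop :=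
  ∀ x : M.World, ¬ Relation.TransGen M.edge x x

/-- Reachability in at most `k` steps. -/
def stepsLe (M : PModel) : ℕ → M.World → M.World → Prop
  | 0 => fun x y => x = y
  | k + 1 => fun x y => stepsLe M k x y ∨ ∃ u, stepsLe M k x u ∧ M.edge u y

/-- The worlds at distance less than `n` from the distinguished point. -/
def PModel.ball (M : PModel) (n : ℕ) : Set M.World :=
  {v | ∃ k, k + 1 ≤ n ∧ stepsLe M k M.pt v}

/-- `e` is an isomorphism between the restrictions `(M↾n, w)` and `(M'↾n, w')`,
i.e. an `n`-isomorphism. -/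
structure IsNIso (M M' : PModel) (n : ℕ)
    (e : {x // x ∈ M.ball n} ≃ {x // x ∈ M'.ball n}) : Prop where
  pt : ∀ hx : M.pt ∈ M.ball n, (e ⟨M.pt, hx⟩).val = M'.pt
  r0 : ∀ x y : {x // x ∈ M.ball n}, M.R0 x.val y.val ↔ M'.R0 (e x).val (e y).val
  r1 : ∀ x y : {x // x ∈ M.ball n}, M.R1 x.val y.val ↔ M'.R1 (e x).val (e y).val
  vals : ∀ (p : ℕ) (x : {x // x ∈ M.ball n}), x.val ∈ M.V p ↔ (e x).val ∈ M'.V p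

/-- The pointed models are `n`-isomorphic. -/
def NIsomorphic (M M' : PModel) (n : ℕ) : Prop := ∃ e, IsNIso M M' n e

/-- `e` is an isomorphism of pointed bimodal models. -/
structure IsIsoP (M M' : PModel) (e : M.World ≃ M'.World) : Prop where
  pt : e M.pt = M'.pt
  r0 : ∀ x y : M.World, M.R0 x y ↔ M'.R0 (e x) (e y)
  r1 : ∀ x y : M.World, M.R1 x y ↔ M'.R1 (e x) (e y)
  vals : ∀ (p : ℕ) (x : M.World), x ∈ M.V p ↔ e x ∈ M'.V p

/-- The pointed models are isomorphic. -/
def IsomorphicP (M M' : PModel) : Prop := ∃ e, IsIsoP M M' e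

/-- The map `f_φ` sending a pointed bimodal model `(M, w)` to the pointed
Kripke model `(𝒢^K(M, w ⊨ φ), ⟨φ, w⟩)` representing its evaluation game,
where `𝒢^K(M, w ⊨ φ) = (𝒢^P(M, w ⊨ φ))^K`. -/
noncomputable def fGame (φ : MuForm (Fin 2)) (M : PModel) : PModel where
  World := EncW (MuForm (Fin 2) × M.World)
  R0 := encR0 (evalPGame M.toK M.pt φ)
  R1 := encR1 (evalPGame M.toK M.pt φ)
  V := encV (evalPGame M.toK M.pt φ)
  pt := EncW.pos (φ, M.pt)

/- ### Modal logics, fusions of logics, GLP -/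

/-- Modal formulas (no fixed points) over a signature `I`, with full
implication and falsum. -/
inductive MForm (I : Type) : Type where
  | prop : ℕ → MForm I
  | fls : MForm I
  | imp : MForm I → MForm I → MForm I
  | box : I → MForm I → MForm I

namespace MForm

variable {I : Type}

def neg (a : MForm I) : MForm I := a.imp .fls

def conj (a b : MForm I) : MForm I := (a.imp b.neg).neg

def diam (i : I) (a : MForm I) : MForm I := (MForm.box i a.neg).neg

def iff (a b : MForm I) : MForm I := conj (a.imp b) (b.imp a)

/-- Kripke semantics for modal formulas. -/
def semM {W : Type} (R : I → W → W → Prop) (V : ℕ → Set W) : MForm I → Set W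
  | prop p => V p
  | fls => ∅
  | imp a b => {w | w ∈ semM R V a → w ∈ semM R V b}
  | box i a => {w | ∀ v, R i w v → v ∈ semM R V a}

/-- Uniform substitution of formulas for propositional symbols. -/
def substP (σ : ℕ → MForm I) : MForm I → MForm I
  | prop p => σ p
  | fls => fls
  | imp a b => imp (substP σ a) (substP σ b)
  | box i a => box i (substP σ a)

/-- The formula only uses modalities from `S`. -/
def UsesOnly (S : Set I) : MForm I → Prop
  | prop _ => True
  | fls => True
  | imp a b => UsesOnly S a ∧ UsesOnly S b
  | box i a => i ∈ S ∧ UsesOnly S a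

/-- The propositional symbol `x` occurs in the formula. -/
def PropOccurs (x : ℕ) : MForm I → Prop
  | prop p => p = x
  | fls => False
  | imp a b => PropOccurs x a ∨ PropOccurs x b
  | box _ a => PropOccurs x a

/-- Every occurrence of the propositional symbol `x` is within the scope of
some modality. -/
def Guarded (x : ℕ) : MForm I → Prop
  | prop p => p ≠ x
  | fls => True
  | imp a b => Guarded x a ∧ Guarded x b
  | box _ _ => True

end MForm

/-- Propositional tautologies: formulas true under every boolean valuation
treating propositional symbols and boxed formulas as atoms. -/
def IsTaut {I : Type} (φ : MForm I) : Prop :=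
  ∀ val : MForm I → Prop, ¬ val .fls →
    (∀ a b : MForm I, val (a.imp b) ↔ (val a → val b)) → val φ

/-- A modal formula is valid on a frame: it holds at every world under
every valuation. -/
def ValidOn {I : Type} (F : Frame I) (φ : MForm I) : Prop :=
  ∀ (V : ℕ → Set F.World) (w : F.World), w ∈ MForm.semM F.R V φ

/-- `L` is a normal modal logic in the signature `S`. -/
structure IsNormalIn {I : Type} (S : Set I) (L : Set (MForm I)) : Prop where
  inSig : ∀ φ ∈ L, MForm.UsesOnly S φ
  taut : ∀ φ : MForm I, MForm.UsesOnly S φ → IsTaut φ → φ ∈ L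
  axK : ∀ i ∈ S, ∀ a b : MForm I, MForm.UsesOnly S a → MForm.UsesOnly S b →
    ((MForm.box i (a.imp b)).imp ((MForm.box i a).imp (MForm.box i b))) ∈ L
  mp : ∀ a b : MForm I, a ∈ L → (a.imp b) ∈ L → b ∈ L
  nec : ∀ i ∈ S, ∀ a : MForm I, a ∈ L → MForm.box i a ∈ L
  subst : ∀ σ : ℕ → MForm I, (∀ p, MForm.UsesOnly S (σ p)) →
    ∀ a ∈ L, a.substP σ ∈ L

/-- The fusion of a family of modal logics: the smallest normal modal logic
in the combined signature containing each of them. -/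
def FusionLogic {I J : Type} (Ls : J → Set (MForm I)) : Set (MForm I) :=
  ⋂₀ {L : Set (MForm I) | IsNormalIn Set.univ L ∧ ∀ j, Ls j ⊆ L}

/-- Extension of a frame for the `j`-th component signature to the full
signature (the other relations are empty; validity of formulas in the
component signature is unaffected). -/
def extendFrame {I J : Type} (c : I → J) (j : J)
    (F : Frame {i : I // c i = j}) : Frame I :=
  ⟨F.World, fun i w v => ∃ h : c i = j, F.R ⟨i, h⟩ w v⟩

/-- The reduct of a frame for the full signature to the `j`-th component. -/
def Frame.reductTo {I J : Type} (c : I → J) (j : J) (F : Frame I) :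
    Frame {i : I // c i = j} :=
  ⟨F.World, fun i => F.R i.val⟩

/-- `L` is characterized by the class `Fs` of frames in the `j`-th component
signature: `L` consists exactly of the formulas of that signature valid on
every frame of `Fs`. -/
def CharacterizedBy {I J : Type} (c : I → J) (j : J) (L : Set (MForm I))
    (Fs : Set (Frame {i : I // c i = j})) : Prop :=
  L = {φ | MForm.UsesOnly {i | c i = j} φ ∧
        ∀ F ∈ Fs, ValidOn (extendFrame c j F) φ}

/-- The fusion of classes of frames in pairwise disjoint signatures. -/
def FusionFrames {I J : Type} (c : I → J)
    (Fs : ∀ j : J, Set (Frame {i : I // c i = j})) : Set (Frame I) :=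
  {F | ∀ j, F.reductTo c j ∈ Fs j}

/-- The finite model property for a logic in signature `S`. -/
def HasFMP {I : Type} (S : Set I) (L : Set (MForm I)) : Prop :=
  ∀ φ : MForm I, MForm.UsesOnly S φ → φ ∉ L →
    ∃ (W : Type) (_ : Finite W) (R : I → W → W → Prop) (V : ℕ → Set W),
      (∀ ψ ∈ L, ∀ w : W, w ∈ MForm.semM R V ψ) ∧ ∃ w : W, w ∉ MForm.semM R V φ

/-- The provability logic `GLP` (signature `ℕ`). -/
inductive GLPthm : MForm ℕ → Prop where
  | taut {φ : MForm ℕ} : IsTaut φ → GLPthm φ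
  | axK (n : ℕ) (a b : MForm ℕ) :
      GLPthm ((MForm.box n (a.imp b)).imp ((MForm.box n a).imp (MForm.box n b)))
  | axLob (n : ℕ) (a : MForm ℕ) :
      GLPthm ((MForm.box n ((MForm.box n a).imp a)).imp (MForm.box n a))
  | axMono {m n : ℕ} (h : m ≤ n) (a : MForm ℕ) :
      GLPthm ((MForm.box m a).imp (MForm.box n a))
  | axStab {m n : ℕ} (h : m ≤ n) (a : MForm ℕ) :
      GLPthm ((MForm.box m a).imp (MForm.box n (MForm.box m a)))
  | axStabD {m n : ℕ} (h : m ≤ n) (a : MForm ℕ) :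
      GLPthm ((MForm.diam m a).imp (MForm.box n (MForm.diam m a)))
  | mp {a b : MForm ℕ} : GLPthm (a.imp b) → GLPthm a → GLPthm b
  | nec (n : ℕ) {a : MForm ℕ} : GLPthm a → GLPthm (MForm.box n a)
  | subst (σ : ℕ → MForm ℕ) {a : MForm ℕ} : GLPthm a → GLPthm (a.substP σ)

/- ### Frame classes for the standard modal logics -/

def FK : Set (Frame Unit) := Set.univ
def FK4 : Set (Frame Unit) := {F | Transitive (F.R ())}
def FS4 : Set (Frame Unit) := {F | Reflexive (F.R ()) ∧ Transitive (F.R ())}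
def FKD45 : Set (Frame Unit) :=
  {F | (∀ w, ∃ v, F.R () w v) ∧ Transitive (F.R ()) ∧
    (∀ w v u, F.R () w v → F.R () w u → F.R () v u)}
def FS5 : Set (Frame Unit) := {F | Equivalence (F.R ())}
def FGL : Set (Frame Unit) :=
  {F | Transitive (F.R ()) ∧ ¬ ∃ f : ℕ → F.World, ∀ k, F.R () (f k) (f (k + 1))}


namespace AH

/-! #### Nested fixed points in complete lattices -/

section Lat

variable {L L' : Type} [CompleteLattice L] [CompleteLattice L']

def mfix (b : Bool) (f : L → L) : L :=
  match b with
  | true => sInf {A | f A ≤ A}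
  | false => sSup {A | A ≤ f A}

theorem mfix_eq (b : Bool) {f : L → L} (hf : Monotone f) : f (mfix b f) = mfix b f := by
  cases b
  · exact OrderHom.map_gfp ⟨f, hf⟩
  · exact OrderHom.map_lfp ⟨f, hf⟩

theorem mfix_le {f : L → L} {A : L} (h : f A ≤ A) : mfix true f ≤ A := sInf_le h

theorem le_mfix {f : L → L} {A : L} (h : A ≤ f A) : A ≤ mfix false f := le_sSup h

theorem mfix_mono (b : Bool) {f g : L → L} (h : ∀ x, f x ≤ g x) : mfix b f ≤ mfix b g := by
  cases b
  · exact sSup_le_sSup fun A hA => le_trans hA (h A)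
  · exact sInf_le_sInf fun A hA => le_trans (h A) hA

theorem mfix_const (b : Bool) (c : L) : mfix b (fun _ => c) = c :=
  (mfix_eq b (f := fun _ => c) (fun _ _ _ => le_rfl)).symm

/-- `h` is monotone with both adjoints. -/
structure Adj (h : L → L') : Prop where
  mono : Monotone h
  up : ∀ T, h (sSup {S | h S ≤ T}) ≤ T
  dn : ∀ T, T ≤ h (sInf {S | T ≤ h S})

theorem mfix_transport {h : L → L'} (hh : Adj h) (b : Bool) {f : L → L} {g : L' → L'}
    (hf : Monotone f) (hg : Monotone g) (hc : ∀ X, h (f X) = g (h X)) :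
    h (mfix b f) = mfix b g := by
  have e : g (h (mfix b f)) = h (mfix b f) := by rw [← hc, mfix_eq b hf]
  have e2 := mfix_eq b hg
  cases b
  · apply le_antisymm
    · exact le_mfix e.ge
    · refine le_trans (hh.dn _) (hh.mono (le_mfix (sInf_le ?_)))
      show _ ≤ h (f _)
      rw [hc]
      conv_lhs => rw [← e2]
      exact hg (hh.dn _)
  · apply le_antisymm
    · refine le_trans (hh.mono (mfix_le (le_sSup ?_))) (hh.up _)
      show h (f _) ≤ _
      rw [hc]
      conv_rhs => rw [← e2]
      exact hg (hh.up _)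
    · exact mfix_le e.le

def nest : ℕ → ℕ → Bool → ((ℕ → L) → L) → (ℕ → L) → L
  | 0, _, _, G, v => G v
  | n + 1, k, b, G, v => mfix b (fun X => nest n (k + 1) (!b) G (Function.update v k X))

theorem upd_mono {v v' : ℕ → L} (h : v ≤ v') (k : ℕ) {X Y : L} (hXY : X ≤ Y) :
    Function.update v k X ≤ Function.update v' k Y := by
  intro i
  by_cases hi : i = k
  · subst hi; simpa using hXY
  · simpa [Function.update_of_ne hi] using h i

theorem nest_mono {G G' : (ℕ → L) → L} (hG : ∀ u u', u ≤ u' → G u ≤ G' u') :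
    ∀ (n k : ℕ) (b : Bool) {v v' : ℕ → L}, v ≤ v' → nest n k b G v ≤ nest n k b G' v' := by
  intro n
  induction n with
  | zero => intro k b v v' h; exact hG _ _ h
  | succ n ih =>
    intro k b v v' h
    exact mfix_mono b fun X => ih _ _ (upd_mono h k le_rfl)

theorem nest_step_mono {G : (ℕ → L) → L} (hG : Monotone G) (n k j : ℕ) (b : Bool) (v : ℕ → L) :
    Monotone (fun X => nest n k b G (Function.update v j X)) := fun _ _ hXY =>
  nest_mono (fun _ _ h => hG h) n k b (upd_mono le_rfl j hXY)

theorem comp_update (h : L → L') (v : ℕ → L) (k : ℕ) (X : L) :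
    (fun i => h (Function.update v k X i)) = Function.update (fun i => h (v i)) k (h X) := by
  funext i
  by_cases hi : i = k
  · subst hi; simp
  · simp [Function.update_of_ne hi]

theorem nest_transport {h : L → L'} (hh : Adj h) {G : (ℕ → L) → L} {G' : (ℕ → L') → L'}
    (hG : Monotone G) (hG' : Monotone G') :
    ∀ (n k : ℕ) (b : Bool) (v : ℕ → L),
      (∀ u : ℕ → L, (∀ i < k, u i = v i) → h (G u) = G' (fun i => h (u i))) →
      h (nest n k b G v) = nest n k b G' (fun i => h (v i)) := by
  intro n
  induction n with
  | zero => intro k b v hc; exact hc v fun _ _ => rfl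
  | succ n ih =>
    intro k b v hc
    refine mfix_transport hh b (nest_step_mono hG n (k+1) k (!b) v)
      (nest_step_mono hG' n (k+1) k (!b) _) ?_
    intro X
    rw [ih (k+1) (!b) (Function.update v k X), comp_update]
    intro u hu
    apply hc
    intro i hi
    rw [hu i (by omega), Function.update_of_ne (by omega)]

theorem nest_inner {G : (ℕ → L) → L} :
    ∀ (n k : ℕ) (b : Bool) (v : ℕ → L),
      (∀ u i X, k + n ≤ i → G (Function.update u i X) = G u) →
      nest (n + 1) k b G v = nest n k b G v := by
  intro n
  induction n with
  | zero =>
    intro k b v hc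
    show mfix b (fun X => G (Function.update v k X)) = G v
    simp only [hc v k _ (le_refl k)]
    exact mfix_const b _
  | succ n ih =>
    intro k b v hc
    show mfix b (fun X => nest (n+1) (k + 1) (!b) G (Function.update v k X)) =
      mfix b (fun X => nest n (k + 1) (!b) G (Function.update v k X))
    congr 1
    funext X
    exact ih _ _ _ fun u i X hi => hc u i X (by omega)

theorem nest_shift {G : (ℕ → L) → L} :
    ∀ (n k : ℕ) (b : Bool) (v : ℕ → L),
      nest n (k + 1) b (fun u => G (fun i => u (i + 1))) v = nest n k b G (fun i => v (i + 1)) := by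
  intro n
  induction n with
  | zero => intro k b v; rfl
  | succ n ih =>
    intro k b v
    show mfix b _ = mfix b _
    congr 1
    funext X
    rw [ih]
    congr 1
    funext i
    by_cases hi : i = k
    · subst hi; simp
    · rw [Function.update_of_ne hi, Function.update_of_ne (by omega)]

theorem nest_dual (G : (ℕ → L) → L) :
    ∀ (n k : ℕ) (b : Bool) (v : ℕ → L),
      nest (L := Lᵒᵈ) n k b G v = nest (L := L) n k (!b) G v := by
  intro n
  induction n with
  | zero => intro k b v; rfl
  | succ n ih =>
    intro k b v
    have : (fun X : L => nest (L := Lᵒᵈ) n (k + 1) (!b) G (Function.update v k X)) =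
      (fun X : L => nest (L := L) n (k + 1) (!(!b)) G (Function.update v k X)) := by
      funext X; exact ih _ _ _
    show mfix (L := Lᵒᵈ) b (fun X : L => nest (L := Lᵒᵈ) n (k + 1) (!b) G (Function.update v k X))
      = mfix (L := L) (!b) _
    rw [this]
    cases b <;> rfl

/-- Diagonal fixed points. -/
theorem mfix_diag (b : Bool) {p : L → L'} (hp : Monotone p) {f : L' → L → L}
    (hf : ∀ a a' x x', a ≤ a' → x ≤ x' → f a x ≤ f a' x') :
    p (mfix b fun X => f (p X) X) = mfix b fun A => p (mfix b fun X => f A X) := by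
  have m1 : Monotone fun X => f (p X) X := fun _ _ h => hf _ _ _ _ (hp h) h
  have m2 : ∀ A, Monotone fun X => f A X := fun A _ _ h => hf _ _ _ _ le_rfl h
  have m3 : Monotone fun A => p (mfix b fun X => f A X) := fun A A' h =>
    hp (mfix_mono b fun x => hf _ _ _ _ h le_rfl)
  have e1 := mfix_eq b m1
  have e3 := mfix_eq b m3
  have e2 := fun A => mfix_eq b (m2 A)
  set Z := mfix b fun X => f (p X) X
  set T := mfix b fun A => p (mfix b fun X => f A X)
  have e4 : f (p (mfix b fun X => f T X)) (mfix b fun X => f T X) = mfix b fun X => f T X := by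
    rw [e3]; exact e2 T
  cases b
  · apply le_antisymm
    · exact le_mfix (hp (le_mfix (f := fun X => f (p Z) X) e1.ge))
    · rw [← e3]
      exact hp (le_mfix (f := fun X => f (p X) X) e4.ge)
  · apply le_antisymm
    · rw [← e3]
      exact hp (mfix_le (f := fun X => f (p X) X) e4.le)
    · exact mfix_le (hp (mfix_le (f := fun X => f (p Z) X) e1.le))

end Lat

/-! #### Alternating automata -/

inductive Stp (Q : Type) : Type where
  | lit : ℕ → Stp Q
  | nlit : ℕ → Stp Q
  | var : ℕ → Stp Q
  | and : Q → Q → Stp Q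
  | or : Q → Q → Stp Q
  | box : Fin 2 → Q → Stp Q
  | dia : Fin 2 → Q → Stp Q

def Stp.map {Q Q' : Type} (f : Q → Q') : Stp Q → Stp Q'
  | lit p => lit p
  | nlit p => nlit p
  | var x => var x
  | and a b => and (f a) (f b)
  | or a b => or (f a) (f b)
  | box i a => box i (f a)
  | dia i a => dia i (f a)

def Stp.ev {Q W : Type} (M : KModel (Fin 2) W) (env : ℕ → Set W) (X : Q → Set W) : Stp Q → Set W
  | lit p => M.V p
  | nlit p => (M.V p)ᶜ
  | var x => env x
  | and a b => X a ∩ X b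
  | or a b => X a ∪ X b
  | box i a => {w | ∀ v, M.R i w v → v ∈ X a}
  | dia i a => {w | ∃ v, M.R i w v ∧ v ∈ X a}

theorem Stp.ev_map {Q Q' W : Type} (M : KModel (Fin 2) W) (env : ℕ → Set W) (X : Q' → Set W)
    (f : Q → Q') (s : Stp Q) : (s.map f).ev M env X = s.ev M env (fun q => X (f q)) := by
  cases s <;> rfl

theorem Stp.ev_mono {Q W : Type} (M : KModel (Fin 2) W) {env env' : ℕ → Set W}
    {X X' : Q → Set W} (he : env ≤ env') (hX : X ≤ X') (s : Stp Q) :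
    s.ev M env X ≤ s.ev M env' X' := by
  cases s with
  | lit p => exact le_rfl
  | nlit p => exact le_rfl
  | var x => exact he x
  | and a b => exact Set.inter_subset_inter (hX a) (hX b)
  | or a b => exact Set.union_subset_union (hX a) (hX b)
  | box i a => exact fun w hw v hv => hX a (hw v hv)
  | dia i a => exact fun w ⟨v, hv, hv'⟩ => ⟨v, hv, hX a hv'⟩

structure Aut : Type 1 where
  Q : Type
  δ : Q → Stp Q
  Ω : Q → ℕ

def Aut.G (A : Aut) {W : Type} (M : KModel (Fin 2) W) (env : ℕ → Set W)
    (v : ℕ → A.Q → Set W) : A.Q → Set W :=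
  fun q => (A.δ q).ev M env (v (A.Ω q))

theorem Aut.G_mono (A : Aut) {W : Type} (M : KModel (Fin 2) W) {env env' : ℕ → Set W}
    (he : env ≤ env') (v v' : ℕ → A.Q → Set W) (hv : v ≤ v') :
    A.G M env v ≤ A.G M env' v' :=
  fun q => Stp.ev_mono M he (hv _) _

abbrev Op : Type 1 := ∀ W : Type, KModel (Fin 2) W → (ℕ → Set W) → Set W

def HasAut (n : ℕ) (b : Bool) (O : Op) : Prop :=
  ∃ (A : Aut) (q0 : A.Q), (∀ q, A.Ω q < n) ∧
    ∀ (W : Type) (M : KModel (Fin 2) W) (env : ℕ → Set W) (v : ℕ → A.Q → Set W),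
      O W M env = nest n 0 b (A.G M env) v q0

theorem HasAut.inner {n : ℕ} {b : Bool} {O : Op} (h : HasAut n b O) : HasAut (n + 1) b O := by
  obtain ⟨A, q0, hΩ, h⟩ := h
  refine ⟨A, q0, fun q => (hΩ q).trans (Nat.lt_succ_self n), fun W M env v => ?_⟩
  rw [h W M env v, nest_inner]
  intro u i X hi
  funext q
  have : A.Ω q ≠ i := by have := hΩ q; omega
  simp only [Aut.G, Function.update_of_ne this]

theorem HasAut.outer {n : ℕ} {b : Bool} {O : Op} (h : HasAut n (!b) O) : HasAut (n + 1) b O := by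
  obtain ⟨A, q0, hΩ, h⟩ := h
  refine ⟨⟨A.Q, A.δ, fun q => A.Ω q + 1⟩, q0, fun q => Nat.succ_lt_succ (hΩ q),
    fun W M env v => ?_⟩
  rw [h W M env (fun i => v (i + 1))]
  have : ∀ X : A.Q → Set W, nest n (0 + 1) (!b) (fun u => A.G M env (fun i => u (i + 1)))
      (Function.update v 0 X) = nest n 0 (!b) (A.G M env) (fun i => v (i + 1)) := by
    intro X
    rw [nest_shift]
    congr 1
  have h2 : nest (n + 1) 0 b (fun u => A.G M env (fun i => u (i + 1))) v
      = nest n 0 (!b) (A.G M env) (fun i => v (i + 1)) := by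
    show mfix b _ = _
    simp only [this]
    exact mfix_const b _
  rw [← h2]
  rfl

theorem adj_precomp {Q Q' W : Type} (f : Q' → Q) :
    Adj (fun (X : Q → Set W) (q : Q') => X (f q)) where
  mono := fun X Y h q => h (f q)
  up := by
    intro T q w hw
    simp only [sSup_apply, Set.iSup_eq_iUnion, Set.mem_iUnion] at hw
    obtain ⟨⟨S, hS⟩, hw⟩ := hw
    exact hS q hw
  dn := by
    intro T q w hw
    simp only [sInf_apply, Set.iInf_eq_iInter, Set.mem_iInter]
    rintro ⟨S, hS⟩
    exact hS q hw

theorem HasAut.step (n : ℕ) (b : Bool) (s : Stp ℕ) :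
    HasAut (n + 1) b (fun _ M env => s.ev M env env) := by
  induction n with
  | succ n ih => exact ih.inner
  | zero =>
    let A : Aut := ⟨Option ℕ, fun q => match q with
      | none => s.map some
      | some x => .var x, fun _ => 0⟩
    refine ⟨A, none, fun _ => Nat.one_pos, fun W M env v => ?_⟩
    have e : A.G M env (Function.update v 0 (nest 1 0 b (A.G M env) v)) =
        nest 1 0 b (A.G M env) v :=
      mfix_eq b (f := fun X => A.G M env (Function.update v 0 X))
        (nest_step_mono (fun _ _ h => A.G_mono M le_rfl _ _ h) 0 1 0 (!b) v)
    generalize nest 1 0 b (A.G M env) v = Z at e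
    have e1 : ∀ x, Z (some x) = env x := fun x => by
      rw [← e]; rfl
    have e2 : Z none = (s.map some).ev M env (Z : Option ℕ → Set W) := by
      conv_lhs => rw [← e]
      simp only [Aut.G, A, Function.update_self]
    rw [e2, Stp.ev_map]
    simp only [e1]

/-- Automaton for substitution. -/
def substAut (A : Aut) (B : ℕ → Aut) (r : ∀ x, (B x).Q) : Aut where
  Q := A.Q ⊕ (Σ x, (B x).Q)
  δ := fun q => match q with
    | .inl q => match A.δ q with
      | .var x => .and (.inr ⟨x, r x⟩) (.inr ⟨x, r x⟩)
      | s => s.map Sum.inl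
    | .inr ⟨x, q⟩ => ((B x).δ q).map fun q' => .inr ⟨x, q'⟩
  Ω := fun q => match q with
    | .inl q => match A.δ q with
      | .var _ => 0
      | _ => A.Ω q
    | .inr ⟨x, q⟩ => (B x).Ω q

theorem substAut_inl (A : Aut) (B : ℕ → Aut) (r : ∀ x, (B x).Q) {W : Type}
    (M : KModel (Fin 2) W) (env : ℕ → Set W) (v : ℕ → (substAut A B r).Q → Set W) (q : A.Q) :
    (substAut A B r).G M env v (.inl q) =
      A.G M (fun x => v 0 (.inr ⟨x, r x⟩)) (fun i q => v i (.inl q)) q := by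
  simp only [Aut.G, substAut]
  cases h : A.δ q <;> simp [Stp.ev, Stp.map]

theorem substAut_inr (A : Aut) (B : ℕ → Aut) (r : ∀ x, (B x).Q) {W : Type}
    (M : KModel (Fin 2) W) (env : ℕ → Set W) (v : ℕ → (substAut A B r).Q → Set W)
    (x : ℕ) (q : (B x).Q) :
    (substAut A B r).G M env v (.inr ⟨x, q⟩) =
      (B x).G M env (fun i q => v i (.inr ⟨x, q⟩)) q := by
  simp only [Aut.G, substAut]
  exact Stp.ev_map _ _ _ _ _

theorem HasAut.subst {n : ℕ} {b : Bool} {O : Op} {P : ℕ → Op} (hO : HasAut (n + 1) b O)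
    (hP : ∀ x, HasAut (n + 1) b (P x)) :
    HasAut (n + 1) b (fun W M env => O W M (fun x => P x W M env)) := by
  obtain ⟨A, q0, hΩ, hA⟩ := hO
  choose B r hΩB hB using hP
  refine ⟨substAut A B r, .inl q0, ?_, ?_⟩
  · rintro (q | ⟨x, q⟩)
    · simp only [substAut]
      split
      · omega
      · exact hΩ q
    · exact hΩB x q
  intro W M env v
  have mC : Monotone ((substAut A B r).G M env) := fun _ _ h => Aut.G_mono _ M le_rfl _ _ h
  have mA : ∀ e, Monotone (A.G M e) := fun e _ _ h => Aut.G_mono _ M le_rfl _ _ h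
  have mB : ∀ x, Monotone ((B x).G M env) := fun x _ _ h => Aut.G_mono _ M le_rfl _ _ h
  refine (hA W M _ (fun i q => v i (.inl q))).trans ?_
  -- the B part
  have tB : ∀ (n k : ℕ) (b : Bool) (v : ℕ → (substAut A B r).Q → Set W) (x : ℕ),
      (fun q => nest n k b ((substAut A B r).G M env) v (.inr ⟨x, q⟩)) =
        nest n k b ((B x).G M env) (fun i q => v i (.inr ⟨x, q⟩)) := fun n k b v x =>
    nest_transport (adj_precomp (fun q : (B x).Q => (.inr ⟨x, q⟩ : (substAut A B r).Q)))
      mC (mB x) n k b v fun u _ => by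
        funext q; exact substAut_inr A B r M env u x q
  let Z : (substAut A B r).Q → Set W := nest (n + 1) 0 b ((substAut A B r).G M env) v
  let fC : ((substAut A B r).Q → Set W) → (substAut A B r).Q → Set W :=
    fun X => nest n 1 (!b) ((substAut A B r).G M env) (Function.update v 0 X)
  have mfC : Monotone fC := nest_step_mono mC n 1 0 (!b) v
  have eZ : fC Z = Z := mfix_eq b mfC
  have hZB : ∀ x, Z (.inr ⟨x, r x⟩) = P x W M env := fun x => by
    rw [hB x W M env (fun i q => v i (.inr ⟨x, q⟩))]
    exact congrFun (tB (n + 1) 0 b v x) (r x)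
  let v' : ℕ → A.Q → Set W := fun i q => v i (.inl q)
  let g : (A.Q → Set W) → A.Q → Set W := fun a =>
    nest n 1 (!b) (A.G M fun x => P x W M env) (Function.update v' 0 a)
  have mg : Monotone g := nest_step_mono (mA _) n 1 0 (!b) v'
  have key : ∀ X : (substAut A B r).Q → Set W, (∀ x, X (.inr ⟨x, r x⟩) = P x W M env) →
      (fun q => fC X (.inl q)) = g (fun q => X (.inl q)) := by
    intro X hX
    have := nest_transport (adj_precomp (fun q : A.Q => (.inl q : (substAut A B r).Q)))
      mC (mA fun x => P x W M env) n 1 (!b) (Function.update v 0 X) (by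
        intro u hu
        funext q
        have h0 : u 0 = X := (hu 0 Nat.one_pos).trans (Function.update_self _ _ _)
        refine (substAut_inl A B r M env u q).trans ?_
        have h1 : (fun x => u 0 (.inr ⟨x, r x⟩)) = fun x => P x W M env := by
          funext x; exact (congrFun h0 _).trans (hX x)
        exact congrArg (fun e => A.G M e (fun i q => u i (.inl q)) q) h1)
    refine this.trans ?_
    show nest _ _ _ _ _ = nest _ _ _ _ _
    congr 1
    exact comp_update (fun (X : (substAut A B r).Q → Set W) (q : A.Q) => X (.inl q)) v 0 X
  have hfix1 : g (fun q => Z (.inl q)) = fun q => Z (.inl q) := by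
    rw [← key Z hZB, eZ]
  let T : A.Q → Set W := mfix b g
  have eT : g T = T := mfix_eq b mg
  let Y : (substAut A B r).Q → Set W := fun q => match q with
    | .inl q => T q
    | .inr q => Z (.inr q)
  have eY : fC Y = Y := by
    funext q
    rcases q with q | ⟨x, q⟩
    · have := congrFun (key Y hZB) q
      refine this.trans ?_
      exact congrFun eT q
    · have h1 := tB n 1 (!b) (Function.update v 0 Y) x
      have h2 := tB n 1 (!b) (Function.update v 0 Z) x
      have h3 : (fun q => fC Y (.inr ⟨x, q⟩)) = fun q => fC Z (.inr ⟨x, q⟩) := by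
        refine h1.trans (Eq.trans ?_ h2.symm)
        congr 1
        funext i q
        cases i <;> rfl
      have h4 := congrFun h3 q
      refine h4.trans ?_
      rw [eZ]
  have goal : T = fun q => Z (.inl q) := by
    cases b
    · exact le_antisymm (fun q => le_mfix (f := fC) eY.ge (.inl q)) (le_mfix (f := g) hfix1.ge)
    · exact le_antisymm (mfix_le (f := g) hfix1.le) (fun q => mfix_le (f := fC) eY.le (.inl q))
  exact congrFun goal q0

/-- Automaton for binding. -/
def bindAut (A : Aut) (q0 : A.Q) (x : ℕ) : Aut where
  Q := A.Q
  δ := fun q => match A.δ q with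
      | .var y => if y = x then .and q0 q0 else .var y
      | s => s
  Ω := fun q => match A.δ q with
      | .var _ => 0
      | _ => A.Ω q

theorem bindAut_G (A : Aut) (q0 : A.Q) (x : ℕ) {W : Type}
    (M : KModel (Fin 2) W) (env : ℕ → Set W) (v : ℕ → A.Q → Set W) :
    (bindAut A q0 x).G M env v = A.G M (Function.update env x (v 0 q0)) v := by
  funext q
  simp only [Aut.G, bindAut]
  cases h : A.δ q <;> simp [Stp.ev]
  rename_i y
  by_cases hy : y = x
  · subst hy; simp [Stp.ev]
  · simp [hy, Stp.ev]

theorem HasAut.bind {n : ℕ} {b : Bool} {O : Op} (x : ℕ) (hO : HasAut (n + 1) b O) :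
    HasAut (n + 1) b (fun W M env => mfix b fun S => O W M (Function.update env x S)) := by
  obtain ⟨A, q0, hΩ, hA⟩ := hO
  refine ⟨bindAut A q0 x, q0, ?_, ?_⟩
  · intro q
    simp only [bindAut]
    split
    · omega
    · exact hΩ q
  intro W M env v
  change ℕ → A.Q → Set W at v
  let f : Set W → (A.Q → Set W) → A.Q → Set W := fun S X =>
    nest n 1 (!b) (A.G M (Function.update env x S)) (Function.update v 0 X)
  have hf : ∀ a a' y y', a ≤ a' → y ≤ y' → f a y ≤ f a' y' := fun a a' y y' h h' =>
    nest_mono (fun u u' hu => A.G_mono M (upd_mono le_rfl x h) u u' hu) n 1 (!b)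
      (upd_mono le_rfl 0 h')
  have hp : Monotone (fun X : A.Q → Set W => X q0) := fun X Y h => h q0
  have hd := mfix_diag b (p := fun X : A.Q → Set W => X q0) hp hf
  have e1 : ∀ S, O W M (Function.update env x S) = (mfix b fun X => f S X) q0 := fun S =>
    hA W M _ v
  simp only [e1]
  refine hd.symm.trans ?_
  show _ = (mfix b fun X => nest n 1 (!b) ((bindAut A q0 x).G M env) (Function.update v 0 X)) q0
  refine congrFun (congrArg (mfix b) ?_) q0
  funext X
  have hid : Adj (fun X : A.Q → Set W => X) := adj_precomp (fun q => q)
  refine (nest_transport hid (G := (bindAut A q0 x).G M env)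
    (fun _ _ h => Aut.G_mono _ M le_rfl _ _ h)
    (fun _ _ h => Aut.G_mono A M le_rfl _ _ h) n 1 (!b) (Function.update v 0 X) ?_).symm
  intro u hu
  have h0 : u 0 = X := by rw [hu 0 Nat.one_pos, Function.update_self]
  rw [bindAut_G, h0]

/-! #### From formulas to automata -/

theorem sem_congr {W : Type} (M : KModel (Fin 2) W) (φ : MuForm (Fin 2)) :
    ∀ env env' : ℕ → Set W, (∀ x ∈ φ.freeVars, env x = env' x) → φ.sem M env = φ.sem M env' := by
  induction φ with
  | prop p => intros; rfl
  | nprop p => intros; rfl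
  | var x => intro e e' h; exact h x rfl
  | and a b iha ihb =>
    intro e e' h
    simp only [MuForm.sem, iha e e' fun x hx => h x (Or.inl hx),
      ihb e e' fun x hx => h x (Or.inr hx)]
  | or a b iha ihb =>
    intro e e' h
    simp only [MuForm.sem, iha e e' fun x hx => h x (Or.inl hx),
      ihb e e' fun x hx => h x (Or.inr hx)]
  | box i a ih => intro e e' h; simp only [MuForm.sem, ih e e' h]
  | dia i a ih => intro e e' h; simp only [MuForm.sem, ih e e' h]
  | mu x a ih =>
    intro e e' h
    have : ∀ A, a.sem M (Function.update e x A) = a.sem M (Function.update e' x A) := fun A =>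
      ih _ _ fun y hy => by
        by_cases hyx : y = x
        · subst hyx; simp
        · rw [Function.update_of_ne hyx, Function.update_of_ne hyx]; exact h y ⟨hy, hyx⟩
    simp only [MuForm.sem, this]
  | nu x a ih =>
    intro e e' h
    have : ∀ A, a.sem M (Function.update e x A) = a.sem M (Function.update e' x A) := fun A =>
      ih _ _ fun y hy => by
        by_cases hyx : y = x
        · subst hyx; simp
        · rw [Function.update_of_ne hyx, Function.update_of_ne hyx]; exact h y ⟨hy, hyx⟩
    simp only [MuForm.sem, this]

theorem sem_mono {W : Type} (M : KModel (Fin 2) W) (φ : MuForm (Fin 2)) :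
    ∀ env env' : ℕ → Set W, env ≤ env' → φ.sem M env ≤ φ.sem M env' := by
  induction φ with
  | prop p => intros; exact le_rfl
  | nprop p => intros; exact le_rfl
  | var x => intro e e' h; exact h x
  | and a b iha ihb => intro e e' h; exact Set.inter_subset_inter (iha e e' h) (ihb e e' h)
  | or a b iha ihb => intro e e' h; exact Set.union_subset_union (iha e e' h) (ihb e e' h)
  | box i a ih => intro e e' h; exact fun w hw v hv => ih e e' h (hw v hv)
  | dia i a ih => intro e e' h; exact fun w ⟨v, hv, hv'⟩ => ⟨v, hv, ih e e' h hv'⟩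
  | mu x a ih => intro e e' h; exact mfix_mono true fun A => ih _ _ (upd_mono h x le_rfl)
  | nu x a ih => intro e e' h; exact mfix_mono false fun A => ih _ _ (upd_mono h x le_rfl)

theorem subst_bind_aux {W : Type} (M : KModel (Fin 2) W) (X y : ℕ) (ψ a : MuForm (Fin 2))
    (hyX : y ≠ X) (h : X ∈ a.freeVars → y ∉ ψ.freeVars)
    (ih : ∀ env, (MuForm.subst X ψ a).sem M env = a.sem M (Function.update env X (ψ.sem M env)))
    (env : ℕ → Set W) (A : Set W) :
    (MuForm.subst X ψ a).sem M (Function.update env y A) =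
      a.sem M (Function.update (Function.update env X (ψ.sem M env)) y A) := by
  rw [ih]
  apply sem_congr
  intro z hz
  by_cases hzX : z = X
  · subst hzX
    rw [Function.update_self, Function.update_of_ne (Ne.symm hyX), Function.update_self]
    apply sem_congr
    intro u hu
    have : u ≠ y := fun e => h hz (e ▸ hu)
    rw [Function.update_of_ne this]
  · by_cases hzy : z = y
    · subst hzy
      rw [Function.update_of_ne hzX, Function.update_self, Function.update_self]
    · rw [Function.update_of_ne hzX, Function.update_of_ne hzy, Function.update_of_ne hzy,
        Function.update_of_ne hzX]

theorem sem_subst {W : Type} (M : KModel (Fin 2) W) (X : ℕ) (ψ a : MuForm (Fin 2)) :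
    MuForm.CaptureFree X ψ a → ∀ env : ℕ → Set W,
      (MuForm.subst X ψ a).sem M env = a.sem M (Function.update env X (ψ.sem M env)) := by
  induction a with
  | prop p => intros; rfl
  | nprop p => intros; rfl
  | var x =>
    intro _ env
    by_cases hx : x = X
    · subst hx; simp [MuForm.subst, MuForm.sem]
    · simp [MuForm.subst, MuForm.sem, hx]
  | and a b iha ihb => intro h env; simp only [MuForm.subst, MuForm.sem, iha h.1, ihb h.2]
  | or a b iha ihb => intro h env; simp only [MuForm.subst, MuForm.sem, iha h.1, ihb h.2]
  | box i a ih => intro h env; simp only [MuForm.subst, MuForm.sem, ih h]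
  | dia i a ih => intro h env; simp only [MuForm.subst, MuForm.sem, ih h]
  | mu y a ih =>
    intro h env
    by_cases hy : y = X
    · subst hy; simp [MuForm.subst, MuForm.sem]
    · have h' := h.resolve_left hy
      simp only [MuForm.subst, if_neg hy, MuForm.sem,
        subst_bind_aux M X y ψ a hy h'.1 (ih h'.2)]
  | nu y a ih =>
    intro h env
    by_cases hy : y = X
    · subst hy; simp [MuForm.subst, MuForm.sem]
    · have h' := h.resolve_left hy
      simp only [MuForm.subst, if_neg hy, MuForm.sem,
        subst_bind_aux M X y ψ a hy h'.1 (ih h'.2)]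

def opOf (φ : MuForm (Fin 2)) : Op := fun _ M env => φ.sem M env

theorem HasAut.stepOp {n : ℕ} {b : Bool} (s : Stp ℕ) {P : ℕ → Op}
    (hP : ∀ x, HasAut (n + 1) b (P x)) :
    HasAut (n + 1) b (fun W M env => s.ev M (fun x => P x W M env) (fun x => P x W M env)) :=
  (HasAut.step n b s).subst hP

theorem HasAut.and' {n : ℕ} {b : Bool} {φ ψ : MuForm (Fin 2)} (h : HasAut (n + 1) b (opOf φ))
    (h' : HasAut (n + 1) b (opOf ψ)) : HasAut (n + 1) b (opOf (φ.and ψ)) :=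
  HasAut.stepOp (.and 0 1) (P := fun x => if x = 0 then opOf φ else opOf ψ) (fun x => by
    split <;> assumption)

theorem HasAut.or' {n : ℕ} {b : Bool} {φ ψ : MuForm (Fin 2)} (h : HasAut (n + 1) b (opOf φ))
    (h' : HasAut (n + 1) b (opOf ψ)) : HasAut (n + 1) b (opOf (φ.or ψ)) :=
  HasAut.stepOp (.or 0 1) (P := fun x => if x = 0 then opOf φ else opOf ψ) (fun x => by
    split <;> assumption)

theorem HasAut.box' {n : ℕ} {b : Bool} {φ : MuForm (Fin 2)} (i : Fin 2)
    (h : HasAut (n + 1) b (opOf φ)) : HasAut (n + 1) b (opOf (φ.box i)) :=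
  HasAut.stepOp (.box i 0) (P := fun _ => opOf φ) (fun _ => h)

theorem HasAut.dia' {n : ℕ} {b : Bool} {φ : MuForm (Fin 2)} (i : Fin 2)
    (h : HasAut (n + 1) b (opOf φ)) : HasAut (n + 1) b (opOf (φ.dia i)) :=
  HasAut.stepOp (.dia i 0) (P := fun _ => opOf φ) (fun _ => h)

theorem HasAut.var' (n : ℕ) (b : Bool) (x : ℕ) : HasAut (n + 1) b (opOf (.var x)) :=
  HasAut.step n b (.var x)

theorem HasAut.subst' {n : ℕ} {b : Bool} {X : ℕ} {a ψ : MuForm (Fin 2)}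
    (h : HasAut (n + 1) b (opOf a)) (h' : HasAut (n + 1) b (opOf ψ))
    (hc : MuForm.CaptureFree X ψ a) : HasAut (n + 1) b (opOf (MuForm.subst X ψ a)) := by
  have := h.subst (P := fun x => if x = X then opOf ψ else opOf (.var x)) (fun x => by
    split
    · exact h'
    · exact HasAut.var' n b x)
  convert this using 1
  funext W M env
  show MuForm.sem M env _ = MuForm.sem M _ a
  rw [sem_subst M X ψ a hc]
  congr 1
  funext x
  by_cases hx : x = X
  · subst hx; simp [opOf]
  · simp [hx, opOf, MuForm.sem]

theorem HasAut.noFix (n : ℕ) (b : Bool) (φ : MuForm (Fin 2)) (h : φ.noFix) :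
    HasAut (n + 1) b (opOf φ) := by
  induction φ with
  | prop p => exact HasAut.step n b (.lit p)
  | nprop p => exact HasAut.step n b (.nlit p)
  | var x => exact HasAut.var' n b x
  | and a c iha ihb => exact (iha h.1).and' (ihb h.2)
  | or a c iha ihb => exact (iha h.1).or' (ihb h.2)
  | box i a ih => exact (ih h).box' i
  | dia i a ih => exact (ih h).dia' i
  | mu x a ih => exact h.elim
  | nu x a ih => exact h.elim

def Good (b : Bool) : ℕ → MuForm (Fin 2) → Prop
  | 0, φ => φ.noFix
  | n + 1, φ => HasAut (n + 1) b (opOf φ)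

theorem Good.same {b : Bool} {n : ℕ} {φ : MuForm (Fin 2)} (h : Good b n φ) :
    Good b (n + 1) φ := by
  cases n with
  | zero => exact HasAut.noFix 0 b φ h
  | succ n => exact HasAut.inner h

theorem Good.other {b : Bool} {n : ℕ} {φ : MuForm (Fin 2)} (h : Good (!b) n φ) :
    Good b (n + 1) φ := by
  cases n with
  | zero => exact HasAut.noFix 0 b φ h
  | succ n => exact HasAut.outer h

theorem sigma_good {n : ℕ} {φ : MuForm (Fin 2)} (h : SigmaMu n φ) : Good true n φ := by
  refine SigmaMu.rec (motive_1 := fun n φ _ => Good true n φ)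
    (motive_2 := fun n φ _ => Good false n φ)
    ?_ ?_ ?_ ?_ ?_ ?_ ?_ ?_ ?_ ?_ ?_ ?_ ?_ ?_ ?_ ?_ ?_ ?_ h
  · intro φ h; exact h
  · intro n φ _ h; exact Good.same h
  · intro n φ _ h; exact Good.other h
  · intro n a b _ _ h h'; exact HasAut.and' h h'
  · intro n a b _ _ h h'; exact HasAut.or' h h'
  · intro n i a _ h; exact HasAut.box' i h
  · intro n i a _ h; exact HasAut.dia' i h
  · intro n X a _ h; exact HasAut.bind X h
  · intro n X a ψ _ _ hc h h'; exact HasAut.subst' h h' hc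
  · intro φ h; exact h
  · intro n φ _ h; exact Good.other h
  · intro n φ _ h; exact Good.same h
  · intro n a b _ _ h h'; exact HasAut.and' h h'
  · intro n a b _ _ h h'; exact HasAut.or' h h'
  · intro n i a _ h; exact HasAut.box' i h
  · intro n i a _ h; exact HasAut.dia' i h
  · intro n X a _ h; exact HasAut.bind X h
  · intro n X a ψ _ _ hc h h'; exact HasAut.subst' h h' hc

/-! #### The universal formulas -/

def disjF (j : ℕ) : MuForm (Fin 2) :=
  .and (.prop (5 + j)) (.or
    (.and (.prop 3) (.dia 0 (.and (.prop 1) (.dia 1 (.and (.prop 0) (.var j))))))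
    (.and (.prop 4) (.box 0 (.or (.nprop 1) (.box 1 (.or (.nprop 0) (.var j)))))))

def bodyF : ℕ → MuForm (Fin 2)
  | 0 => .dia 0 (.prop 2)
  | j + 1 => .or (bodyF j) (disjF j)

def bindF : ℕ → ℕ → Bool → MuForm (Fin 2) → MuForm (Fin 2)
  | 0, _, _, φ => φ
  | n + 1, k, true, φ => .mu k (bindF n (k + 1) false φ)
  | n + 1, k, false, φ => .nu k (bindF n (k + 1) true φ)

theorem bodyF_noFix (n : ℕ) : (bodyF n).noFix := by
  induction n with
  | zero => trivial
  | succ n ih => exact ⟨ih, by simp [disjF, MuForm.noFix]⟩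

theorem bindF_class {φ : MuForm (Fin 2)} (h : φ.noFix) (n : ℕ) :
    ∀ k, SigmaMu n (bindF n k true φ) ∧ PiMu n (bindF n k false φ) := by
  induction n with
  | zero => intro k; exact ⟨.base h, .base h⟩
  | succ n ih => intro k; exact ⟨.muI (.upP (ih _).2), .nuI (.upS (ih _).1)⟩

theorem sem_bindF {W : Type} (M : KModel (Fin 2) W) (φ : MuForm (Fin 2)) (n : ℕ) :
    ∀ (k : ℕ) (b : Bool) (env : ℕ → Set W),
      (bindF n k b φ).sem M env = nest n k b (fun v => φ.sem M v) env := by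
  induction n with
  | zero => intros; rfl
  | succ n ih =>
    intro k b env
    cases b
    · simp only [bindF, MuForm.sem, ih]; rfl
    · simp only [bindF, MuForm.sem, ih]; rfl

theorem mem_bodyF {W : Type} (M : KModel (Fin 2) W) (env : ℕ → Set W) (w : W) (n : ℕ) :
    w ∈ (bodyF n).sem M env ↔
      (∃ z, M.R 0 w z ∧ z ∈ M.V 2) ∨ ∃ j < n, w ∈ (disjF j).sem M env := by
  induction n with
  | zero => simp [bodyF, MuForm.sem]
  | succ n ih =>
    show w ∈ (bodyF n).sem M env ∨ w ∈ (disjF n).sem M env ↔ _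
    rw [ih]
    constructor
    · rintro ((h | ⟨j, hj, h⟩) | h)
      · exact Or.inl h
      · exact Or.inr ⟨j, by omega, h⟩
      · exact Or.inr ⟨n, by omega, h⟩
    · rintro (h | ⟨j, hj, h⟩)
      · exact Or.inl (Or.inl h)
      · rcases Nat.lt_succ_iff_lt_or_eq.1 hj with hj | rfl
        · exact Or.inl (Or.inr ⟨j, hj, h⟩)
        · exact Or.inr h

/-! #### The self-referential model -/

inductive Wd (Q : Type) : Type where
  | root : Wd Q
  | pos : Q → Wd Q → Wd Q
  | edge : Q → Wd Q → Wd Q → Wd Q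

section Diag

variable (A : Aut) (q0 : A.Q) (k0 k1 : Bool)

open Classical in
noncomputable def mk (q : A.Q) (w : Wd A.Q) : Wd A.Q :=
  if q = q0 ∧ w = .root then .root else .pos q w

theorem mk_inj {q q' : A.Q} {w w' : Wd A.Q} (h : mk A q0 q w = mk A q0 q' w') :
    q = q' ∧ w = w' := by
  unfold mk at h
  split at h <;> split at h
  · rename_i h1 h2; exact ⟨h1.1.trans h2.1.symm, h1.2.trans h2.2.symm⟩
  · cases h
  · cases h
  · cases h; exact ⟨rfl, rfl⟩

theorem mk_root : mk A q0 q0 .root = .root := by simp [mk]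

def isEdge {Q : Type} : Wd Q → Prop
  | .edge _ _ _ => True
  | _ => False

theorem mk_notEdge (q : A.Q) (w : Wd A.Q) : ¬ isEdge (mk A q0 q w) := by
  unfold mk; split <;> exact fun h => h

noncomputable def src : Wd A.Q → Wd A.Q
  | .edge q w _ => mk A q0 q w
  | x => x

def tgt : Wd A.Q → Wd A.Q
  | .edge _ _ y => y
  | x => x

theorem src_of {x : Wd A.Q} (h : ¬ isEdge x) : src A q0 x = x := by
  cases x <;> first | rfl | exact (h trivial).elim

theorem tgt_of {x : Wd A.Q} (h : ¬ isEdge x) : tgt A x = x := by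
  cases x <;> first | rfl | exact (h trivial).elim

def R0 (x y : Wd A.Q) : Prop :=
  if k0 = true then src A q0 x = src A q0 y else isEdge y ∧ ¬ isEdge x ∧ src A q0 y = x

def R1 (x y : Wd A.Q) : Prop :=
  if k1 = true then tgt A x = tgt A y else isEdge x ∧ ¬ isEdge y ∧ tgt A x = y

def RR (i : Fin 2) : Wd A.Q → Wd A.Q → Prop :=
  if i = 0 then R0 A q0 k0 else R1 A k1

theorem R0_edge (q : A.Q) (w z : Wd A.Q) (hz : isEdge z) :
    R0 A q0 k0 (mk A q0 q w) z ↔ ∃ y, z = .edge q w y := by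
  have hn := mk_notEdge A q0 q w
  cases z with
  | root => exact hz.elim
  | pos => exact hz.elim
  | edge q' w' y =>
    have : (∃ y', Wd.edge q' w' y = .edge q w y') ↔ mk A q0 q' w' = mk A q0 q w := by
      constructor
      · rintro ⟨y', h⟩; cases h; rfl
      · intro h; obtain ⟨rfl, rfl⟩ := mk_inj A q0 h; exact ⟨y, rfl⟩
    rw [this]
    unfold R0
    split
    · rw [src_of A q0 hn]; exact eq_comm
    · exact ⟨fun h => h.2.2, fun h => ⟨trivial, hn, h⟩⟩

theorem R1_edge (q : A.Q) (w y z : Wd A.Q) (hz : ¬ isEdge z) :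
    R1 A k1 (.edge q w y) z ↔ z = y := by
  unfold R1
  split
  · rw [tgt_of A hz]; exact eq_comm
  · exact ⟨fun h => h.2.2.symm, fun h => ⟨trivial, hz, h.symm⟩⟩

def valid (q : A.Q) (w y : Wd A.Q) : Prop :=
  match A.δ q with
  | .and a b => y = mk A q0 a w ∨ y = mk A q0 b w
  | .or a b => y = mk A q0 a w ∨ y = mk A q0 b w
  | .box i a => ∃ v, RR A q0 k0 k1 i w v ∧ y = mk A q0 a v
  | .dia i a => ∃ v, RR A q0 k0 k1 i w v ∧ y = mk A q0 a v
  | _ => False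

theorem valid_pos {q : A.Q} {w y : Wd A.Q} (h : valid A q0 k0 k1 q w y) :
    ∃ a v, y = mk A q0 a v := by
  unfold valid at h
  split at h
  · rcases h with h | h <;> exact ⟨_, _, h⟩
  · rcases h with h | h <;> exact ⟨_, _, h⟩
  · obtain ⟨v, _, h⟩ := h; exact ⟨_, _, h⟩
  · obtain ⟨v, _, h⟩ := h; exact ⟨_, _, h⟩
  · exact h.elim

def isEx {Q : Type} : Stp Q → Prop
  | .and _ _ => True
  | .box _ _ => True
  | _ => False

def isAll {Q : Type} : Stp Q → Prop
  | .or _ _ => True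
  | .dia _ _ => True
  | .var _ => True
  | _ => False

def lab (q : A.Q) (p : ℕ) : Prop :=
  p = 0 ∨ (p = 3 ∧ isEx (A.δ q)) ∨ (p = 4 ∧ isAll (A.δ q)) ∨ p = 5 + A.Ω q

def val : Wd A.Q → ℕ → Prop
  | .root, p => lab A q0 p
  | .pos q _, p => lab A q p
  | .edge q w y, p => (p = 1 ∧ valid A q0 k0 k1 q w y) ∨
      (p = 2 ∧ match A.δ q with
        | .lit p' => ¬ val w p'
        | .nlit p' => val w p'
        | _ => False)

theorem val_mk (q : A.Q) (w : Wd A.Q) (p : ℕ) : val A q0 k0 k1 (mk A q0 q w) p ↔ lab A q p := by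
  unfold mk
  split
  · rename_i h; rw [h.1]; simp [val]
  · simp [val]

theorem val_zero (z : Wd A.Q) : val A q0 k0 k1 z 0 ↔ ¬ isEdge z := by
  cases z <;> simp [val, isEdge, lab]

theorem val_edge {z : Wd A.Q} {p : ℕ} (hp : p = 1 ∨ p = 2) (h : val A q0 k0 k1 z p) :
    isEdge z := by
  cases z with
  | edge => trivial
  | root =>
    simp only [val, lab] at h
    omega
  | pos q w =>
    simp only [val, lab] at h
    omega

def MM : KModel (Fin 2) (Wd A.Q) := ⟨RR A q0 k0 k1, fun p => {w | val A q0 k0 k1 w p}⟩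

theorem MM_two (q : A.Q) (w : Wd A.Q) :
    (∃ z, RR A q0 k0 k1 0 (mk A q0 q w) z ∧ val A q0 k0 k1 z 2) ↔
      match A.δ q with
        | .lit p' => ¬ val A q0 k0 k1 w p'
        | .nlit p' => val A q0 k0 k1 w p'
        | _ => False := by
  constructor
  · rintro ⟨z, hz, hv⟩
    obtain ⟨y, rfl⟩ := (R0_edge A q0 k0 q w z (val_edge A q0 k0 k1 (Or.inr rfl) hv)).1 hz
    simpa [val] using hv
  · intro h
    refine ⟨.edge q w .root, (R0_edge A q0 k0 q w (.edge q w .root) trivial).2 ⟨_, rfl⟩, ?_⟩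
    simpa [val] using h

theorem MM_dia (q : A.Q) (w : Wd A.Q) (X : Set (Wd A.Q)) :
    (∃ z, RR A q0 k0 k1 0 (mk A q0 q w) z ∧ val A q0 k0 k1 z 1 ∧
      ∃ y, RR A q0 k0 k1 1 z y ∧ val A q0 k0 k1 y 0 ∧ y ∈ X) ↔
      ∃ y, valid A q0 k0 k1 q w y ∧ y ∈ X := by
  constructor
  · rintro ⟨z, hz, hv, y, hy, hy0, hyX⟩
    obtain ⟨y', rfl⟩ := (R0_edge A q0 k0 q w z (val_edge A q0 k0 k1 (Or.inl rfl) hv)).1 hz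
    have := (R1_edge A k1 q w y' y ((val_zero A q0 k0 k1 y).1 hy0)).1 hy
    subst this
    refine ⟨y, ?_, hyX⟩
    simpa [val] using hv
  · rintro ⟨y, hv, hyX⟩
    have hy : ¬ isEdge y := by
      obtain ⟨a, v, rfl⟩ := valid_pos A q0 k0 k1 hv
      exact mk_notEdge A q0 a v
    refine ⟨.edge q w y, (R0_edge A q0 k0 q w (.edge q w y) trivial).2 ⟨_, rfl⟩, by simpa [val] using hv,
      y, (R1_edge A k1 q w y y hy).2 rfl, (val_zero A q0 k0 k1 y).2 hy, hyX⟩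

theorem mem_disjF (q : A.Q) (w : Wd A.Q) (env : ℕ → Set (Wd A.Q)) (j : ℕ) :
    mk A q0 q w ∈ (disjF j).sem (MM A q0 k0 k1) env ↔
      j = A.Ω q ∧ ((isEx (A.δ q) ∧ ∃ y, valid A q0 k0 k1 q w y ∧ y ∈ env j) ∨
        (isAll (A.δ q) ∧ ∀ y, valid A q0 k0 k1 q w y → y ∈ env j)) := by
  have e1 : val A q0 k0 k1 (mk A q0 q w) (5 + j) ↔ j = A.Ω q := by
    rw [val_mk]; unfold lab; omega
  have e3 : val A q0 k0 k1 (mk A q0 q w) 3 ↔ isEx (A.δ q) := by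
    rw [val_mk]; unfold lab; simp; omega
  have e4 : val A q0 k0 k1 (mk A q0 q w) 4 ↔ isAll (A.δ q) := by
    rw [val_mk]; unfold lab; simp; omega
  have e5 := MM_dia A q0 k0 k1 q w (env j)
  have e6 := MM_dia A q0 k0 k1 q w (env j)ᶜ
  have e7 : (∀ z, RR A q0 k0 k1 0 (mk A q0 q w) z → (¬ val A q0 k0 k1 z 1 ∨
      ∀ y, RR A q0 k0 k1 1 z y → (¬ val A q0 k0 k1 y 0 ∨ y ∈ env j))) ↔
      ∀ y, valid A q0 k0 k1 q w y → y ∈ env j := by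
    constructor
    · intro h y hy
      by_contra hn
      obtain ⟨z, h1, h2, y, h3, h4, h5⟩ := e6.2 ⟨y, hy, hn⟩
      rcases h z h1 with h | h
      · exact h h2
      · rcases h y h3 with h | h
        · exact h h4
        · exact h5 h
    · intro h z hz
      by_contra hn
      push Not at hn
      obtain ⟨h2, y, h3, h4, h5⟩ := hn
      obtain ⟨y, h6, h7⟩ := e6.1 ⟨z, hz, h2, y, h3, h4, h5⟩
      exact h7 (h y h6)
  show (val A q0 k0 k1 (mk A q0 q w) (5 + j) ∧ ((val A q0 k0 k1 (mk A q0 q w) 3 ∧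
      (∃ z, RR A q0 k0 k1 0 (mk A q0 q w) z ∧ val A q0 k0 k1 z 1 ∧
      ∃ y, RR A q0 k0 k1 1 z y ∧ val A q0 k0 k1 y 0 ∧ y ∈ env j)) ∨
      (val A q0 k0 k1 (mk A q0 q w) 4 ∧ (∀ z, RR A q0 k0 k1 0 (mk A q0 q w) z →
      (¬ val A q0 k0 k1 z 1 ∨
      ∀ y, RR A q0 k0 k1 1 z y → (¬ val A q0 k0 k1 y 0 ∨ y ∈ env j)))))) ↔ _
  rw [e1, e3, e4, e5, e7]

theorem MM_step (n : ℕ) (hΩ : ∀ q, A.Ω q < n) (u : ℕ → Set (Wd A.Q)) (q : A.Q) (w : Wd A.Q) :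
    mk A q0 q w ∉ (bodyF n).sem (MM A q0 k0 k1) u ↔
      w ∈ A.G (MM A q0 k0 k1) (fun _ => ∅) (fun j q => {w | mk A q0 q w ∉ u j}) q := by
  have h1 : mk A q0 q w ∈ (bodyF n).sem (MM A q0 k0 k1) u ↔
      ((match A.δ q with
        | .lit p' => ¬ val A q0 k0 k1 w p'
        | .nlit p' => val A q0 k0 k1 w p'
        | _ => False) ∨
      ((isEx (A.δ q) ∧ ∃ y, valid A q0 k0 k1 q w y ∧ y ∈ u (A.Ω q)) ∨
        (isAll (A.δ q) ∧ ∀ y, valid A q0 k0 k1 q w y → y ∈ u (A.Ω q)))) := by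
    rw [mem_bodyF, ← MM_two]
    refine or_congr Iff.rfl ?_
    simp only [mem_disjF]
    constructor
    · rintro ⟨j, _, rfl, h⟩; exact h
    · intro h; exact ⟨_, hΩ q, rfl, h⟩
  rw [h1]
  unfold Aut.G valid
  cases hδ : A.δ q with
  | lit p => simp [Stp.ev, isEx, isAll, MM]
  | nlit p => simp [Stp.ev, isEx, isAll, MM]
  | var x => simp [Stp.ev, isEx, isAll]
  | and a b => simp [Stp.ev, isEx, isAll]
  | or a b => simp [Stp.ev, isEx, isAll]; tauto
  | box i a =>
    simp [Stp.ev, isEx, isAll, MM]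
  | dia i a =>
    simp [Stp.ev, isEx, isAll, MM]

theorem diag (n : ℕ) (b : Bool) (hΩ : ∀ q, A.Ω q < n) (env : ℕ → Set (Wd A.Q)) :
    ∃ v, ∀ q w, mk A q0 q w ∉ (bindF n 0 (!b) (bodyF n)).sem (MM A q0 k0 k1) env ↔
      w ∈ nest n 0 b (A.G (MM A q0 k0 k1) (fun _ => ∅)) v q := by
  let h : Set (Wd A.Q) → (A.Q → Set (Wd A.Q))ᵒᵈ := fun S =>
    OrderDual.toDual (fun q => {w | mk A q0 q w ∉ S})
  have hh : Adj h :=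
    { mono := fun S S' hS q w hw hn => hw (hS hn)
      up := by
        intro T q w hw hn
        obtain ⟨S, hS, hm⟩ := hn
        exact hS q hw hm
      dn := by
        intro T q w hw
        by_contra hn
        refine hw ?_
        rintro S hS
        by_contra hm
        exact hn (hS q hm) }
  have := nest_transport hh (G := fun v => (bodyF n).sem (MM A q0 k0 k1) v)
    (G' := fun v => OrderDual.toDual (A.G (MM A q0 k0 k1) (fun _ => ∅) v))
    (fun _ _ h => sem_mono _ _ _ _ h)
    (fun u u' hu => A.G_mono _ le_rfl u' u hu) n 0 (!b) env (by
      intro u _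
      funext q
      ext w
      exact MM_step A q0 k0 k1 n hΩ u q w)
  have h2 := nest_dual (A.G (MM A q0 k0 k1) (fun _ => ∅)) n 0 (!b)
    (fun i q => {w | mk A q0 q w ∉ env i})
  rw [Bool.not_not] at h2
  refine ⟨fun i q => {w | mk A q0 q w ∉ env i}, fun q w => ?_⟩
  rw [← h2, sem_bindF]
  have h3 := congrFun this q
  exact Set.ext_iff.1 h3 w

end Diag

theorem main (C0 C1 : Set (Frame Unit)) (h0 : FS5 ⊆ C0 ∨ C0 = FGL) (h1 : FS5 ⊆ C1 ∨ C1 = FGL)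
    (n : ℕ) : ∃ φ : MuForm (Fin 2), PiMu (n + 1) φ ∧
      ∀ ψ : MuForm (Fin 2), SigmaMu (n + 1) ψ → ¬ EquivOver (fusion2 C0 C1) φ ψ := by
  refine ⟨bindF (n + 1) 0 false (bodyF (n + 1)), (bindF_class (bodyF_noFix _) _ _).2, ?_⟩
  intro ψ hψ he
  obtain ⟨A, q0, hΩ, hA⟩ := sigma_good hψ
  have k0 : ∃ k0 : Bool, (⟨Wd A.Q, fun _ => R0 A q0 k0⟩ : Frame Unit) ∈ C0 := by
    rcases h0 with h0 | rfl
    · refine ⟨true, h0 ?_⟩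
      show Equivalence _
      simp only [R0, if_true]
      exact ⟨fun _ => rfl, fun h => h.symm, fun h h' => h.trans h'⟩
    · refine ⟨false, ?_⟩
      simp only [FGL, R0]
      exact ⟨fun x y z h h' => (h'.2.1 h.1).elim, fun ⟨f, hf⟩ => (hf 1).2.1 (hf 0).1⟩
  have k1 : ∃ k1 : Bool, (⟨Wd A.Q, fun _ => R1 A k1⟩ : Frame Unit) ∈ C1 := by
    rcases h1 with h1 | rfl
    · refine ⟨true, h1 ?_⟩
      show Equivalence _
      simp only [R1, if_true]
      exact ⟨fun _ => rfl, fun h => h.symm, fun h h' => h.trans h'⟩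
    · refine ⟨false, ?_⟩
      simp only [FGL, R1]
      exact ⟨fun x y z h h' => (h.2.1 h'.1).elim, fun ⟨f, hf⟩ => (hf 0).2.1 (hf 1).1⟩
  obtain ⟨k0, hk0⟩ := k0
  obtain ⟨k1, hk1⟩ := k1
  have := he ⟨Wd A.Q, RR A q0 k0 k1⟩ ⟨hk0, hk1⟩ (fun p => {w | val A q0 k0 k1 w p}) (fun _ => ∅)
  obtain ⟨v, hd⟩ := diag A q0 k0 k1 (n + 1) true hΩ (fun _ => ∅)
  have h3 := hd q0 .root
  rw [← hA _ (MM A q0 k0 k1) (fun _ => ∅) v, mk_root] at h3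
  have h4 : Wd.root ∈ (bindF (n + 1) 0 false (bodyF (n + 1))).sem (MM A q0 k0 k1) (fun _ => ∅) ↔
      Wd.root ∈ ψ.sem (MM A q0 k0 k1) (fun _ => ∅) := Set.ext_iff.1 this _
  change _ ↔ Wd.root ∈ ψ.sem (MM A q0 k0 k1) (fun _ => ∅) at h3
  rw [← h4] at h3
  exact (iff_not_self h3.symm)

theorem class_cases {C : Set (Frame Unit)}
    (h : C ∈ ({FK, FK4, FS4, FKD45, FS5, FGL} : Set (Set (Frame Unit)))) :
    FS5 ⊆ C ∨ C = FGL := by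
  simp only [Set.mem_insert_iff, Set.mem_singleton_iff] at h
  rcases h with rfl | rfl | rfl | rfl | rfl | rfl
  · exact Or.inl (Set.subset_univ _)
  · exact Or.inl fun F hF x y z h h' => hF.trans h h'
  · exact Or.inl fun F hF => ⟨fun x => hF.refl x, fun x y z h h' => hF.trans h h'⟩
  · exact Or.inl fun F hF => ⟨fun w => ⟨w, hF.refl w⟩, fun x y z h h' => hF.trans h h',
      fun w v u h h' => hF.trans (hF.symm h) h'⟩
  · exact Or.inl le_rfl
  · exact Or.inr rfl

end AH

/-- The μ-calculus' alternation hierarchy is strict over the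
fusion `F_{L₀} ⊗ F_{L₁}` for `L₀, L₁ ∈ {K, K4, S4, KD45, S5, GL}`. -/
theorem alternation_hierarchy_strict_fusion_standard_logics
    (C0 C1 : Set (Frame Unit))
    (h0 : C0 ∈ ({FK, FK4, FS4, FKD45, FS5, FGL} : Set (Set (Frame Unit))))
    (h1 : C1 ∈ ({FK, FK4, FS4, FKD45, FS5, FGL} : Set (Set (Frame Unit)))) :
    ∀ n : ℕ, ∃ φ : MuForm (Fin 2), (SigmaMu (n + 1) φ ∨ PiMu (n + 1) φ) ∧
      ∀ ψ : MuForm (Fin 2), (SigmaMu n ψ ∨ PiMu n ψ) →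
        ¬ EquivOver (fusion2 C0 C1) φ ψ := by
  intro n
  obtain ⟨φ, hφ, h⟩ := AH.main C0 C1 (AH.class_cases h0) (AH.class_cases h1) n
  refine ⟨φ, Or.inr hφ, fun ψ hψ => h ψ ?_⟩
  rcases hψ with hψ | hψ
  · exact .upS hψ
  · exact .upP hψ
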